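/- arXiv:2101.02345 — 6 statements merged into one kernel-verified Lean document; each statement's English description precedes it below -/
import Mathlib

section
/- For every integer k ≥ 1, γ(k) = (1 − p^(2^k) − q^(2^k))/2. -/
theorem stmt_1 (p q : ℝ) (hp0 : 0 < p) (hp1 : p < 1) (hq : q = 1 - p)
    (γ : ℕ → ℝ) (hγ1 : γ 1 = p * q)
    (hγ : ∀ k : ℕ, 1 ≤ k →
      γ (k + 1) = (1 + p ^ 2 ^ k + q ^ 2 ^ k) * γ k + p ^ 2 ^ k * q ^ 2 ^ k) :
    ∀ k : ℕ, 1 ≤ k → γ k = (1 - p ^ 2 ^ k - q ^ 2 ^ k) / 2 := by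
  intro k hk
  induction k, hk using Nat.le_induction with
  | base =>
    rw [hγ1, hq]
    ring
  | succ k hk ih =>
    rw [hγ k hk, ih, pow_succ 2 k, pow_mul, pow_mul]
    ring
end

section
/- For every integer k ≥ 1, 2·γ(k) < 1; that is, the sequence (γ(k)) is bounded above by 1/2. -/
theorem stmt_3 (p q : ℝ) (hp0 : 0 < p) (hp1 : p < 1) (hq : q = 1 - p)
    (γ : ℕ → ℝ) (hγ1 : γ 1 = p * q)
    (hγ : ∀ k : ℕ, 1 ≤ k →
      γ (k + 1) = (1 + p ^ 2 ^ k + q ^ 2 ^ k) * γ k + p ^ 2 ^ k * q ^ 2 ^ k) :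
    ∀ k : ℕ, 1 ≤ k → 2 * γ k < 1 := by
  have closed_form : ∀ k : ℕ, 1 ≤ k → 2 * γ k = 1 - p ^ 2 ^ k - q ^ 2 ^ k := by
    intro k hk
    induction k, hk using Nat.le_induction with
    | base => rw [hγ1, hq]; ring
    | succ k hk ih =>
      rw [hγ k hk, pow_succ 2 k, pow_mul, pow_mul]
      linear_combination (1 + p ^ 2 ^ k + q ^ 2 ^ k) * ih
  intro k hk
  have hq0 : 0 < q := by linarith
  linarith [closed_form k hk, pow_pos hp0 (2 ^ k), pow_pos hq0 (2 ^ k)]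
end

section
/- The sequence (γ(k)) converges to 1/2 as k tends to infinity; in other words, the asymptotic extraction tree outputs a head or a tail with total probability 1. -/
theorem stmt_4 (p q : ℝ) (hp0 : 0 < p) (hp1 : p < 1) (hq : q = 1 - p)
    (γ : ℕ → ℝ) (hγ1 : γ 1 = p * q)
    (hγ : ∀ k : ℕ, 1 ≤ k →
      γ (k + 1) = (1 + p ^ 2 ^ k + q ^ 2 ^ k) * γ k + p ^ 2 ^ k * q ^ 2 ^ k) :
    Filter.Tendsto γ Filter.atTop (nhds (1 / 2)) := by
  have closed_form : ∀ k : ℕ, 1 ≤ k → γ k = (1 - (p ^ 2 ^ k + q ^ 2 ^ k)) / 2 := by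
    intro k hk
    induction k, hk using Nat.le_induction with
    | base => rw [hγ1, hq]; ring
    | succ k hk ih =>
      rw [hγ k hk, ih, pow_succ 2 k, pow_mul, pow_mul]
      ring
  have two_pow : Filter.Tendsto (fun k : ℕ => 2 ^ k) Filter.atTop Filter.atTop :=
    tendsto_pow_atTop_atTop_of_one_lt one_lt_two
  have hp : Filter.Tendsto (fun k : ℕ => p ^ 2 ^ k) Filter.atTop (nhds 0) :=
    (tendsto_pow_atTop_nhds_zero_of_lt_one hp0.le hp1).comp two_pow
  have hq' : Filter.Tendsto (fun k : ℕ => q ^ 2 ^ k) Filter.atTop (nhds 0) :=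
    (tendsto_pow_atTop_nhds_zero_of_lt_one (by linarith) (by linarith)).comp two_pow
  have lim : Filter.Tendsto (fun k : ℕ => (1 - (p ^ 2 ^ k + q ^ 2 ^ k)) / 2)
      Filter.atTop (nhds (1 / 2)) := by
    simpa using ((hp.add hq').const_sub 1).div_const 2
  refine lim.congr' ?_
  filter_upwards [Filter.eventually_ge_atTop 1] with k hk
  exact (closed_form k hk).symm
end

section
/- For every integer k ≥ 2, γ(k) = p^(2^(k−1))·q^(2^(k−1)) + Σ_{i=0}^{k−2} (p·q)^(2^i) · Π_{j=i+1}^{k−1} (1 + p^(2^j) + q^(2^j)). -/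
/-- Closed form of the solution of a first-order affine recurrence. -/
theorem affine_recurrence_closed_form {R : Type*} [CommSemiring R] (a b x : ℕ → R)
    (h0 : x 0 = b 0) (hx : ∀ n, x (n + 1) = a (n + 1) * x n + b (n + 1)) (n : ℕ) :
    x n = b n + ∑ i ∈ Finset.range n, b i * ∏ j ∈ Finset.Icc (i + 1) n, a j := by
  induction n with
  | zero => simp [h0]
  | succ n ih =>
    have hsum : ∑ i ∈ Finset.range n, b i * ∏ j ∈ Finset.Icc (i + 1) (n + 1), a j =
        a (n + 1) * ∑ i ∈ Finset.range n, b i * ∏ j ∈ Finset.Icc (i + 1) n, a j := by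
      rw [Finset.mul_sum]
      refine Finset.sum_congr rfl fun i hi => ?_
      have hi' := Finset.mem_range.mp hi
      rw [Finset.prod_Icc_succ_top (by omega)]
      ring
    rw [hx, ih, Finset.sum_range_succ, hsum, Finset.Icc_self, Finset.prod_singleton]
    ring

theorem stmt_5 (p q : ℝ) (hp0 : 0 < p) (hp1 : p < 1) (hq : q = 1 - p)
    (γ : ℕ → ℝ) (hγ1 : γ 1 = p * q)
    (hγ : ∀ k : ℕ, 1 ≤ k →
      γ (k + 1) = (1 + p ^ 2 ^ k + q ^ 2 ^ k) * γ k + p ^ 2 ^ k * q ^ 2 ^ k) :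
    ∀ k : ℕ, 2 ≤ k →
      γ k = p ^ 2 ^ (k - 1) * q ^ 2 ^ (k - 1) +
        ∑ i ∈ Finset.range (k - 1),
          (p * q) ^ 2 ^ i *
            ∏ j ∈ Finset.Icc (i + 1) (k - 1), (1 + p ^ 2 ^ j + q ^ 2 ^ j) := by
  intro k hk
  obtain ⟨n, rfl⟩ : ∃ n, k = n + 1 := ⟨k - 1, by omega⟩
  rw [Nat.add_sub_cancel, ← mul_pow]
  refine affine_recurrence_closed_form (fun j => 1 + p ^ 2 ^ j + q ^ 2 ^ j)
    (fun j => (p * q) ^ 2 ^ j) (fun j => γ (j + 1)) (by simpa using hγ1) (fun m => ?_) n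
  simpa only [mul_pow] using hγ (m + 1) (by omega)
end

section
/- For every integer k ≥ 1, no element d of the multiset D(k) satisfies d ≡ 1 (mod 4); equivalently, no leaf of the trimmed extraction tree has depth congruent to 1 modulo 4. -/
/-- `Eset k D` is the multiset `E(k+1)` of the construction: from the multiset
`{2^k + d : d ∈ D}` (depths after hanging a copy of the level-`k` tree under a
restart branch of depth `2^k`), remove one occurrence of `2^(k+1)` and insert
one occurrence of `2^(k+1) - 1` (pruning the maximal-depth leaf). -/
def Eset (k : ℕ) (D : Multiset ℕ) : Multiset ℕ :=
  (2 ^ (k + 1) - 1) ::ₘ ((D.map (fun d => 2 ^ k + d)).erase (2 ^ (k + 1)))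

/-- `Dm k` is the multiset `D(k)` of depths of the output leaves of the trimmed
extraction tree of height `2^k`: `D(1) = {2, 2}` and
`D(k+1) = D(k) + E(k+1) + E(k+1)` for `k ≥ 1`. -/
def Dm : ℕ → Multiset ℕ
  | 0 => 0
  | 1 => {2, 2}
  | (n + 2) => Dm (n + 1) + Eset (n + 1) (Dm (n + 1)) + Eset (n + 1) (Dm (n + 1))

theorem mod_four_ne_one_of_mem_Eset {k : ℕ} (hk : 2 ≤ k) {D : Multiset ℕ}
    (hD : ∀ d ∈ D, ¬ d % 4 = 1) : ∀ d ∈ Eset k D, ¬ d % 4 = 1 := by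
  obtain ⟨m, rfl⟩ := Nat.exists_eq_add_of_le' hk
  have hpos : 0 < 2 ^ m := by positivity
  intro d hd
  rcases Multiset.mem_cons.mp hd with rfl | hd
  · rw [pow_succ, pow_add]
    omega
  · obtain ⟨e, he, rfl⟩ := Multiset.mem_map.mp (Multiset.mem_of_mem_erase hd)
    have := hD e he
    rw [pow_add]
    omega

theorem stmt_12 : ∀ k : ℕ, 1 ≤ k → ∀ d ∈ Dm k, ¬ d % 4 = 1 := by
  intro k hk
  induction k, hk using Nat.le_induction with
  | base => simp [Dm]
  | succ n hn ih =>
    obtain ⟨m, rfl⟩ := Nat.exists_eq_add_of_le' hn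
    rcases m with _ | m
    · simp [Dm, Eset]
    · intro d hd
      have hE := mod_four_ne_one_of_mem_Eset (by omega : 2 ≤ m + 1 + 1) ih
      rw [Dm, Multiset.mem_add, Multiset.mem_add] at hd
      rcases hd with (hd | hd) | hd
      exacts [ih d hd, hE d hd, hE d hd]
end

section
/- For every integer k ≥ 1, every element d of the multiset D(k) satisfies 2 ≤ d ≤ 2^k, and moreover 2^k occurs in D(k); in particular the replacement step defining D(k+1) is well defined and the trimmed extraction tree of level k has height exactly 2^k. -/
theorem bounds_of_mem_Eset {k : ℕ} {D : Multiset ℕ} (hk : 1 ≤ k)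
    (hD : ∀ d ∈ D, 2 ≤ d ∧ d ≤ 2 ^ k) :
    ∀ d ∈ Eset k D, 2 ≤ d ∧ d ≤ 2 ^ (k + 1) := by
  intro d hd
  have hpow : 2 ^ (k + 1) = 2 * 2 ^ k := pow_succ' 2 k
  have hk2 : 2 ≤ 2 ^ k := Nat.le_self_pow (by omega) 2
  rcases Multiset.mem_cons.mp hd with rfl | hd
  · omega
  · obtain ⟨e, he, rfl⟩ := Multiset.mem_map.mp (Multiset.mem_of_mem_erase hd)
    have := hD e he
    omega

theorem count_two_pow_Eset (k : ℕ) (D : Multiset ℕ) :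
    (Eset k D).count (2 ^ (k + 1)) = D.count (2 ^ k) - 1 := by
  have hne : 2 ^ (k + 1) ≠ 2 ^ (k + 1) - 1 := by
    have := Nat.two_pow_pos (k + 1)
    omega
  have hmap : (D.map (fun d => 2 ^ k + d)).count (2 ^ (k + 1)) = D.count (2 ^ k) := by
    rw [pow_succ, mul_two]
    exact Multiset.count_map_eq_count' _ D (add_right_injective _) _
  rw [Eset, Multiset.count_cons_of_ne hne, Multiset.count_erase_self, hmap]

theorem bounds_of_mem_Dm {k : ℕ} (hk : 1 ≤ k) : ∀ d ∈ Dm k, 2 ≤ d ∧ d ≤ 2 ^ k := by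
  induction k, hk using Nat.le_induction with
  | base => simp [Dm]
  | succ k hk ih =>
    obtain ⟨n, rfl⟩ := Nat.exists_eq_add_of_le' hk
    have hE := bounds_of_mem_Eset hk ih
    intro d hd
    rw [Dm, Multiset.mem_add, Multiset.mem_add] at hd
    rcases hd with (hd | hd) | hd
    · exact ⟨(ih d hd).1, (ih d hd).2.trans (Nat.pow_le_pow_right two_pos (Nat.le_succ _))⟩
    · exact hE d hd
    · exact hE d hd

/-- The maximal depth occurs at least twice, so it survives the removal of one occurrence. -/
theorem two_le_count_two_pow_Dm {k : ℕ} (hk : 1 ≤ k) : 2 ≤ (Dm k).count (2 ^ k) := by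
  induction k, hk using Nat.le_induction with
  | base => simp [Dm]
  | succ k hk ih =>
    obtain ⟨n, rfl⟩ := Nat.exists_eq_add_of_le' hk
    rw [Dm, Multiset.count_add, Multiset.count_add, count_two_pow_Eset]
    omega

theorem stmt_13 :
    ∀ k : ℕ, 1 ≤ k → (∀ d ∈ Dm k, 2 ≤ d ∧ d ≤ 2 ^ k) ∧ (2 ^ k : ℕ) ∈ Dm k := by
  intro k hk
  exact ⟨bounds_of_mem_Dm hk,
    Multiset.count_pos.mp (two_pos.trans_le (two_le_count_two_pow_Dm hk))⟩
end
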